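/- Let v be even, n = v/2, let k be even with n ≥ k ≥ 4, and let h = k/2, and suppose n = 2h (so v = 2k). Let X be a set of v points partitioned into two parts X₁, X₂ of size n. Suppose there exists a resolvable (n, h, 2) covering design with p parallel classes, each parallel class consisting of exactly two blocks; let P₁, …, P_p be such parallel classes defined on X₁ and R₁, …, R_p such parallel classes defined on X₂. For i = 1, 2, let (X_i, B_i) be an (n, k, 4) covering design. Define B = B₁ ∪ B₂ ∪ ⋃_{i=1}^{p} { P ∪ R : P ∈ P_i, R ∈ R_i }. Then (X, B) is a (v, k, 4, 5) cover. -/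

import Mathlib

/-- `(X, Bs)` is a `(|X|, k, t, m)` cover: `Bs` is a collection of `k`-subsets of `X` such that
every `m`-subset of `X` intersects at least one block of `Bs` in at least `t` points. -/
def IsCover {α : Type*} [DecidableEq α] (X : Finset α) (Bs : Finset (Finset α))
    (k t m : ℕ) : Prop :=
  (∀ B ∈ Bs, B ⊆ X ∧ B.card = k) ∧
  ∀ M ⊆ X, M.card = m → ∃ B ∈ Bs, t ≤ (M ∩ B).card

/-- A cover also traps every subset with at least `m` points. -/
lemma IsCover.exists_le_card_inter {α : Type*} [DecidableEq α] {X : Finset α}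
    {Bs : Finset (Finset α)} {k t m : ℕ} (hc : IsCover X Bs k t m) {M : Finset α}
    (hM : M ⊆ X) (hm : m ≤ M.card) : ∃ B ∈ Bs, t ≤ (M ∩ B).card := by
  obtain ⟨N, hNM, hN⟩ := Finset.exists_subset_card_eq hm
  obtain ⟨B, hB, ht⟩ := hc.2 N (hNM.trans hM) hN
  exact ⟨B, hB, ht.trans (Finset.card_le_card (Finset.inter_subset_inter_right hNM))⟩

/-- If two blocks cover `X`, one of them contains two of any three points of `X`. -/
lemma exists_two_le_card_inter_of_card_eq_two {α : Type*} [DecidableEq α] {X : Finset α}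
    {C : Finset (Finset α)} (hC : C.card = 2) (hcov : ∀ x ∈ X, ∃ B ∈ C, x ∈ B)
    {T : Finset α} (hT : T ⊆ X) (h3 : 3 ≤ T.card) : ∃ B ∈ C, 2 ≤ (T ∩ B).card := by
  have hTC : T ⊆ C.biUnion (T ∩ ·) := by
    intro x hx
    obtain ⟨B, hB, hxB⟩ := hcov x (hT hx)
    exact Finset.mem_biUnion.2 ⟨B, hB, Finset.mem_inter.2 ⟨hx, hxB⟩⟩
  by_contra! hlt
  have hle := (Finset.card_le_card hTC).trans
    (Finset.card_biUnion_le_card_mul C (T ∩ ·) 1 fun B hB => Nat.lt_succ_iff.1 (hlt B hB))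
  omega

/-- Intersection sizes with a union of two disjoint blocks add up. -/
lemma add_le_card_inter_union {α : Type*} [DecidableEq α] {M X1 X2 A B : Finset α} {a b : ℕ}
    (hd : Disjoint A B) (ha : a ≤ ((M ∩ X1) ∩ A).card) (hb : b ≤ ((M ∩ X2) ∩ B).card) :
    a + b ≤ (M ∩ (A ∪ B)).card := by
  rw [Finset.inter_union_distrib_left, Finset.card_union_of_disjoint
    (hd.mono Finset.inter_subset_right Finset.inter_subset_right)]
  exact Nat.add_le_add
    (ha.trans (Finset.card_le_card
      (Finset.inter_subset_inter_right Finset.inter_subset_left)))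
    (hb.trans (Finset.card_le_card
      (Finset.inter_subset_inter_right Finset.inter_subset_left)))

/-- Trapping-quadruples construction for `(v,k,4,5)` covers: as in the `(v,k,4,6)`
construction but with `n = 2h` (so `v = 2k`) and every parallel class consisting of
exactly two blocks; then `B₁ ∪ B₂ ∪ ⋃ᵢ {P ∪ R : P ∈ Pᵢ, R ∈ Rᵢ}` is a `(v,k,4,5)` cover. -/
theorem trapping_quadruples_k45 {α : Type*} [DecidableEq α]
    (v n k h p : ℕ) (hv : Even v) (hn : n = v / 2) (hkeven : Even k)
    (hk4 : 4 ≤ k) (hkn : k ≤ n) (hh : h = k / 2) (hn2h : n = 2 * h)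
    (X X1 X2 : Finset α) (hXpart : X = X1 ∪ X2) (hX12 : Disjoint X1 X2)
    (hX1 : X1.card = n) (hX2 : X2.card = n)
    (P R : Fin p → Finset (Finset α))
    (hPblock : ∀ i, ∀ B ∈ P i, B ⊆ X1 ∧ B.card = h)
    (hPclass : ∀ i, ∀ x ∈ X1, ∃! B, B ∈ P i ∧ x ∈ B)
    (hPtwo : ∀ i, (P i).card = 2)
    (hPcov : IsCover X1 (Finset.univ.biUnion P) h 2 2)
    (hRblock : ∀ i, ∀ B ∈ R i, B ⊆ X2 ∧ B.card = h)
    (hRclass : ∀ i, ∀ x ∈ X2, ∃! B, B ∈ R i ∧ x ∈ B)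
    (hRtwo : ∀ i, (R i).card = 2)
    (hRcov : IsCover X2 (Finset.univ.biUnion R) h 2 2)
    (B1 B2 : Finset (Finset α))
    (hB1 : IsCover X1 B1 k 4 4) (hB2 : IsCover X2 B2 k 4 4) :
    IsCover X
      (B1 ∪ B2 ∪ Finset.univ.biUnion (fun i =>
        (P i).biUnion fun Pb => (R i).image fun Rb => Pb ∪ Rb))
      k 4 5 := by
  have hdisj : ∀ i, ∀ A ∈ P i, ∀ B ∈ R i, Disjoint A B := fun i A hA B hB =>
    hX12.mono (hPblock i A hA).1 (hRblock i B hB).1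
  subst hXpart
  refine ⟨fun B hB => ?_, fun M hM hM5 => ?_⟩
  · simp only [Finset.mem_union, Finset.mem_biUnion, Finset.mem_image, Finset.mem_univ,
      true_and] at hB
    rcases hB with (hB | hB) | ⟨i, A, hA, C, hC, rfl⟩
    · exact ⟨(hB1.1 B hB).1.trans Finset.subset_union_left, (hB1.1 B hB).2⟩
    · exact ⟨(hB2.1 B hB).1.trans Finset.subset_union_right, (hB2.1 B hB).2⟩
    · refine ⟨Finset.union_subset_union (hPblock i A hA).1 (hRblock i C hC).1, ?_⟩
      rw [Finset.card_union_of_disjoint (hdisj i A hA C hC), (hPblock i A hA).2,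
        (hRblock i C hC).2]
      obtain ⟨c, rfl⟩ := hkeven
      omega
  · have hsum : (M ∩ X1).card + (M ∩ X2).card = 5 := by
      rw [← Finset.card_union_of_disjoint
        (hX12.mono Finset.inter_subset_right Finset.inter_subset_right),
        ← Finset.inter_union_distrib_left, Finset.inter_eq_left.2 hM, hM5]
    have mem_cross : ∀ i, ∀ A ∈ P i, ∀ C ∈ R i, A ∪ C ∈ B1 ∪ B2 ∪ Finset.univ.biUnion
        (fun i => (P i).biUnion fun Pb => (R i).image fun Rb => Pb ∪ Rb) := by
      intro i A hA C hC
      simp only [Finset.mem_union, Finset.mem_biUnion, Finset.mem_image, Finset.mem_univ,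
        true_and]
      exact Or.inr ⟨i, A, hA, C, hC, rfl⟩
    have hcases : 4 ≤ (M ∩ X1).card ∨ 4 ≤ (M ∩ X2).card ∨
        (3 ≤ (M ∩ X1).card ∧ 2 ≤ (M ∩ X2).card) ∨
        (2 ≤ (M ∩ X1).card ∧ 3 ≤ (M ∩ X2).card) := by omega
    rcases hcases with h4 | h4 | ⟨h1, h2⟩ | ⟨h1, h2⟩
    · obtain ⟨B, hB, ht⟩ := hB1.exists_le_card_inter Finset.inter_subset_right h4
      exact ⟨B, Finset.mem_union_left _ (Finset.mem_union_left _ hB), ht.trans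
        (Finset.card_le_card (Finset.inter_subset_inter_right Finset.inter_subset_left))⟩
    · obtain ⟨B, hB, ht⟩ := hB2.exists_le_card_inter Finset.inter_subset_right h4
      exact ⟨B, Finset.mem_union_left _ (Finset.mem_union_right _ hB), ht.trans
        (Finset.card_le_card (Finset.inter_subset_inter_right Finset.inter_subset_left))⟩
    · obtain ⟨C, hC, hCt⟩ := hRcov.exists_le_card_inter Finset.inter_subset_right h2
      obtain ⟨i, -, hCi⟩ := Finset.mem_biUnion.1 hC
      obtain ⟨A, hA, hAt⟩ := exists_two_le_card_inter_of_card_eq_two (hPtwo i)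
        (fun x hx => (hPclass i x hx).exists) Finset.inter_subset_right h1
      exact ⟨A ∪ C, mem_cross i A hA C hCi,
        add_le_card_inter_union (hdisj i A hA C hCi) hAt hCt⟩
    · obtain ⟨A, hA, hAt⟩ := hPcov.exists_le_card_inter Finset.inter_subset_right h1
      obtain ⟨i, -, hAi⟩ := Finset.mem_biUnion.1 hA
      obtain ⟨C, hC, hCt⟩ := exists_two_le_card_inter_of_card_eq_two (hRtwo i)
        (fun x hx => (hRclass i x hx).exists) Finset.inter_subset_right h2
      exact ⟨A ∪ C, mem_cross i A hAi C hC,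
        add_le_card_inter_union (hdisj i A hAi C hC) hAt hCt⟩
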